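/- Let T = (Q, Σ, δ) be an S-automaton and let L ⊆ Q* be a finitely suffix-closed language of state sequences whose image L∘ = {𝐪∘ ∣ 𝐪 ∈ L} is infinite. Then the empty word ε has infinite potential with respect to T and L, i.e. the orbit sizes |L∘x| for x ∈ Σ* are unbounded. -/

import Mathlib

/- Common framework for automaton semigroups acting on finite and infinite words.

An S-automaton over states `Q` and alphabet `A` is given by a partial deterministic
transition function `δ : Q → A → Option (A × Q)` (with `δ q a = some (b, p)` encoding
the transition `q –a/b→ p`). -/

namespace AutOrbit

variable {Q A : Type*}

/-- The partial action `q∘` of a single state on a finite word. -/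
def stateAct (δ : Q → A → Option (A × Q)) : Q → List A → Option (List A)
  | _, [] => some []
  | q, a :: u => (δ q a).bind fun bp => (stateAct δ bp.2 u).map fun v => bp.1 :: v

/-- The partial action `𝐪∘` of a state sequence `𝐪 = q_n … q_1` (written left-to-right,
head of the list is `q_n`; the rightmost state `q_1` is applied first). -/
def seqAct (δ : Q → A → Option (A × Q)) (l : List Q) (u : List A) : Option (List A) :=
  l.foldr (fun q acc => acc.bind (stateAct δ q)) (some u)

/-- The length-`n` prefix of an ω-word. -/
def pre (ξ : ℕ → A) (n : ℕ) : List A := List.ofFn fun i : Fin n => ξ i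

/-- The `L`-orbit `L∘u` of a finite word `u`. -/
def orbit (δ : Q → A → Option (A × Q)) (L : Set (List Q)) (u : List A) : Set (List A) :=
  {v | ∃ l ∈ L, seqAct δ l u = some v}

/-- The `L`-orbit `L∘ξ` of an ω-word `ξ`: all ω-words `η` such that some `𝐪 ∈ L` is
defined on `ξ` with `𝐪∘ξ = η` (i.e. `𝐪∘` maps every prefix of `ξ` to the
corresponding prefix of `η`). -/
def omegaOrbit (δ : Q → A → Option (A × Q)) (L : Set (List Q)) (ξ : ℕ → A) :
    Set (ℕ → A) :=
  {η | ∃ l ∈ L, ∀ n, seqAct δ l (pre ξ n) = some (pre η n)}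

/-- The set of partial maps `L∘ = {𝐪∘ ∣ 𝐪 ∈ L}`. -/
def mapsOf (δ : Q → A → Option (A × Q)) (L : Set (List Q)) :
    Set (List A → Option (List A)) :=
  {f | ∃ l ∈ L, f = seqAct δ l}

/-- `L ⊆ F*` is suffix-closed over `F`: every `𝐪 ∈ L` factorizes into factors from `F`
such that every suffix (as a word over the alphabet `F`) of the factorization is
again in `L`. -/
def SuffixClosedOver (F L : Set (List Q)) : Prop :=
  ∀ l ∈ L, ∃ fs : List (List Q),
    (∀ f ∈ fs, f ∈ F) ∧ fs.flatten = l ∧ ∀ i, (fs.drop i).flatten ∈ L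

/-- `L` is finitely suffix-closed: suffix-closed over some finite nonempty `F ⊆ Q*`. -/
def FinitelySuffixClosed (L : Set (List Q)) : Prop :=
  ∃ F : Set (List Q), F.Finite ∧ F.Nonempty ∧ SuffixClosedOver F L

/-- `u` has infinite potential w.r.t. `δ` and `L`: the orbit sizes `|L∘ux|` are unbounded. -/
def InfinitePotential (δ : Q → A → Option (A × Q)) (L : Set (List Q)) (u : List A) : Prop :=
  ∀ C : ℕ, ∃ x : List A, C < (orbit δ L (u ++ x)).ncard

/-- The `i`-th power `𝐪^i` of a state sequence. -/
def listPow (l : List Q) (i : ℕ) : List Q := (List.replicate i l).flatten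

/-- `𝐪∘` has torsion: two distinct positive powers induce the same partial map. -/
def HasTorsion (δ : Q → A → Option (A × Q)) (l : List Q) : Prop :=
  ∃ i j : ℕ, 1 ≤ i ∧ 1 ≤ j ∧ i ≠ j ∧ seqAct δ (listPow l i) = seqAct δ (listPow l j)

/-- The automaton is complete: `δ` is total. -/
def Complete (δ : Q → A → Option (A × Q)) : Prop := ∀ q a, (δ q a).isSome

/-- The automaton is invertible: for every state, the letter-to-output-letter map is a
bijection of the alphabet (each output letter is produced by exactly one input letter). -/
def Invertible (δ : Q → A → Option (A × Q)) : Prop :=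
  ∀ q b, ∃! a, ∃ p, δ q a = some (b, p)

/-- A G-automaton: a complete invertible S-automaton. -/
def GAutomaton (δ : Q → A → Option (A × Q)) : Prop := Complete δ ∧ Invertible δ

/-- Reversibility: for every input letter `a` and target state `p` there is at most one
transition `q –a/b→ p`. -/
def Reversible (δ : Q → A → Option (A × Q)) : Prop :=
  ∀ a p q₁ b₁ q₂ b₂, δ q₁ a = some (b₁, p) → δ q₂ a = some (b₂, p) → q₁ = q₂

/-- Reversibility of the inverse automaton: for every output letter `b` and target
state `p` there is at most one transition `q –a/b→ p`. -/
def InvReversible (δ : Q → A → Option (A × Q)) : Prop :=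
  ∀ b p q₁ a₁ q₂ a₂, δ q₁ a₁ = some (b, p) → δ q₂ a₂ = some (b, p) → q₁ = q₂ ∧ a₁ = a₂

/-- Bi-reversibility: the automaton and its inverse automaton are both reversible. -/
def BiReversible (δ : Q → A → Option (A × Q)) : Prop := Reversible δ ∧ InvReversible δ

/-- The dual automaton `∂T`: states are letters, letters are states; it has a transition
`a –q/p→ b` for every transition `q –a/b→ p` of `T`. -/
def dual (δ : Q → A → Option (A × Q)) : A → Q → Option (Q × A) :=
  fun a q => (δ q a).map fun bp => (bp.2, bp.1)

/-- Adjacency of states in the underlying undirected graph of the automaton. -/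
def Adj (δ : Q → A → Option (A × Q)) (q p : Q) : Prop :=
  (∃ a b, δ q a = some (b, p)) ∨ (∃ a b, δ p a = some (b, q))

/-- `P` is (the state set of) a connected component of the automaton. -/
def IsComponent (δ : Q → A → Option (A × Q)) (P : Set Q) : Prop :=
  ∃ q, P = {p | Relation.ReflTransGen (Adj δ) q p}

/-- The sub-automaton induced on `P` (with all transitions among states of `P`)
is reversible. -/
def SubReversible (δ : Q → A → Option (A × Q)) (P : Set Q) : Prop :=
  ∀ a : A, ∀ p ∈ P, ∀ q₁ b₁ q₂ b₂, q₁ ∈ P → q₂ ∈ P →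
    δ q₁ a = some (b₁, p) → δ q₂ a = some (b₂, p) → q₁ = q₂

/-- The inverse of the sub-automaton induced on `P` is reversible. -/
def SubInvReversible (δ : Q → A → Option (A × Q)) (P : Set Q) : Prop :=
  ∀ b : A, ∀ p ∈ P, ∀ q₁ a₁ q₂ a₂, q₁ ∈ P → q₂ ∈ P →
    δ q₁ a₁ = some (b, p) → δ q₂ a₂ = some (b, p) → q₁ = q₂ ∧ a₁ = a₂

/-- The sub-automaton induced on `P` is bi-reversible. -/
def SubBiReversible (δ : Q → A → Option (A × Q)) (P : Set Q) : Prop :=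
  SubReversible δ P ∧ SubInvReversible δ P

/-- For a complete automaton, the (total) action of a state on a finite word. -/
noncomputable def totAct (δ : Q → A → Option (A × Q)) (q : Q) (u : List A) : List A :=
  (stateAct δ q u).getD u

/-- The action of a state of the automaton (`Sum.inl`) or of its inverse automaton
(`Sum.inr`): for a G-automaton, `totAct δ q` is a bijection of `Σ*` and the inverse
state `q̄` acts as its inverse bijection. -/
noncomputable def gAct (δ : Q → A → Option (A × Q)) : Q ⊕ Q → List A → List A
  | Sum.inl q => totAct δ q
  | Sum.inr q => Function.invFun (totAct δ q)

/-- Action of a sequence over `Q ⊔ Q̄` (rightmost entry applied first). -/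
noncomputable def gSeqAct (δ : Q → A → Option (A × Q)) (l : List (Q ⊕ Q)) (u : List A) :
    List A :=
  l.foldr (fun s v => gAct δ s v) u

/-- The automaton group `G(T) = {𝐪∘ ∣ 𝐪 ∈ (Q ⊔ Q̄)⁺}` as a set of maps on `Σ*`. -/
def autGroup (δ : Q → A → Option (A × Q)) : Set (List A → List A) :=
  {f | ∃ l : List (Q ⊕ Q), l ≠ [] ∧ f = gSeqAct δ l}

/-- The ultimately periodic ω-word `u (a v)^ω`. -/
def ultPer (u : List A) (a : A) (v : List A) (n : ℕ) : A :=
  if h : n < u.length then u.get ⟨n, h⟩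
  else (a :: v).get ⟨(n - u.length) % (a :: v).length, Nat.mod_lt _ (by simp)⟩

/-- Run of a single state on a word, returning the output word and the final state. -/
def runState (δ : Q → A → Option (A × Q)) : Q → List A → Option (List A × Q)
  | q, [] => some ([], q)
  | q, a :: u => (δ q a).bind fun bp =>
      (runState δ bp.2 u).map fun vr => (bp.1 :: vr.1, vr.2)

/-- Run of a state sequence `𝐪` on a word `u`, returning the output word `𝐪∘u` and the
residual state sequence `𝐪·u` (the dual action). -/
def runSeq (δ : Q → A → Option (A × Q)) : List Q → List A → Option (List A × List Q)
  | [], u => some (u, [])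
  | q :: l, u => (runSeq δ l u).bind fun vr =>
      (runState δ q vr.1).map fun wp => (wp.1, wp.2 :: vr.2)

/-- Nodes of the `L`-orbital transducer over `F` of `u`: words reached from `u` along a
path of `F`-labeled edges whose reverse label (a word over `F`) lies in `L`. -/
def transNodes (δ : Q → A → Option (A × Q)) (F L : Set (List Q)) (u : List A) :
    Set (List A) :=
  {v | ∃ fs : List (List Q), (∀ f ∈ fs, f ∈ F) ∧ fs.flatten ∈ L ∧
        ∃ r, runSeq δ fs.flatten u = some (v, r)}

/-- Edges of the `L`-orbital transducer over `F` of `u`: an edge `v –𝐩/𝐨→ w` with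
`𝐩 ∈ F`, input label `𝐩`, output label `𝐨 = 𝐩·v`, lying on a path from `u` whose
reverse label is in `L`. -/
def transEdge (δ : Q → A → Option (A × Q)) (F L : Set (List Q)) (u : List A)
    (v : List A) (p o : List Q) (w : List A) : Prop :=
  p ∈ F ∧ ∃ fs : List (List Q), (∀ f ∈ fs, f ∈ F) ∧ (p :: fs).flatten ∈ L ∧
    (∃ r, runSeq δ fs.flatten u = some (v, r)) ∧ runSeq δ p v = some (w, o)

/-- Isomorphism of the `L`-orbital transducers over `F` of `u₁` and `u₂`: a bijection of
the node sets mapping `u₁` to `u₂` and preserving labeled edges in both directions. -/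
def TransducerIso (δ : Q → A → Option (A × Q)) (F L : Set (List Q)) (u₁ u₂ : List A) :
    Prop :=
  ∃ φ : List A → List A,
    Set.BijOn φ (transNodes δ F L u₁) (transNodes δ F L u₂) ∧ φ u₁ = u₂ ∧
    ∀ v ∈ transNodes δ F L u₁, ∀ w ∈ transNodes δ F L u₁, ∀ p o : List Q,
      (transEdge δ F L u₁ v p o w ↔ transEdge δ F L u₂ (φ v) p o (φ w))


/-- The composition of the partial maps `act f` along a list, rightmost entry first. -/
def runMaps {F X : Type*} (act : F → X → Option X) (fs : List F) (x : X) : Option X :=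
  fs.foldr (fun f acc => acc.bind (act f)) (some x)

/-- The nodes of the `F`-labeled graph `R` reached from the set `S` along a list of labels,
rightmost label first. -/
def reach {F N : Type*} (R : F → N → N → Prop) (S : Set N) (fs : List F) : Set N :=
  fs.foldr (fun f U => {j | ∃ i ∈ U, R f i j}) S

/-- Partial maps along a suffix-closed set of lists can be read off in the orbital graphs. -/
theorem runMaps_eq_some_iff_reach {F X N : Type*} (act : F → X → Option X)
    (M : Set (List F)) (hM : ∀ f fs, f :: fs ∈ M → fs ∈ M) (x : X) (d : N → X)
    (hd : ∀ fs ∈ M, ∀ y, runMaps act fs x = some y → y ∈ Set.range d)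
    (fs : List F) (hfs : fs ∈ M) (y : X) :
    runMaps act fs x = some y ↔
      y ∈ d '' reach (fun f i j => act f (d i) = some (d j)) {i | d i = x} fs := by
  induction fs generalizing y with
  | nil =>
    constructor
    · intro h
      obtain ⟨j, rfl⟩ := hd [] hfs y h
      exact ⟨j, (Option.some.inj h).symm, rfl⟩
    · rintro ⟨j, hj, rfl⟩
      exact congrArg some (Eq.symm hj)
  | cons f fs ih =>
    have ih := ih (hM f fs hfs)
    have hcons : runMaps act (f :: fs) x = (runMaps act fs x).bind (act f) := rfl
    constructor
    · intro h
      obtain ⟨j, rfl⟩ := hd _ hfs y h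
      rw [hcons, Option.bind_eq_some_iff] at h
      obtain ⟨z, hz, hzj⟩ := h
      obtain ⟨i, hi, rfl⟩ := (ih z).1 hz
      exact ⟨j, ⟨i, hi, hzj⟩, rfl⟩
    · rintro ⟨j, ⟨i, hi, hij⟩, rfl⟩
      rw [hcons, (ih (d i)).2 ⟨i, hi, rfl⟩]
      exact hij

/-- A suffix-closed set of compositions of finitely many partial maps is finite if its orbits
have bounded size: there are only finitely many orbital graphs up to isomorphism. -/
theorem finite_image_runMaps {F X N : Type*} [Finite F] [Finite N] (act : F → X → Option X)
    (M : Set (List F)) (hM : ∀ f fs, f :: fs ∈ M → fs ∈ M)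
    (hd : ∀ x, ∃ d : N → X, ∀ fs ∈ M, ∀ y, runMaps act fs x = some y → y ∈ Set.range d) :
    (runMaps act '' M).Finite := by
  choose d hd using hd
  let graph : X → (F → N → N → Prop) × Set N := fun x =>
    (fun f i j => act f (d x i) = some (d x j), {i | d x i = x})
  let decode : ((F → N → N → Prop) × Set N → Set N) → X → Set X := fun c x =>
    d x '' c (graph x)
  let rel : (X → Option X) → X → Set X := fun g x => {y | g x = some y}
  have hrel : Function.Injective rel := fun g g' h => by
    funext x
    ext y
    exact Set.ext_iff.1 (congrFun h x) y
  refine Set.Finite.of_finite_image (f := rel) ((Set.finite_range decode).subset ?_) hrel.injOn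
  rintro _ ⟨_, ⟨fs, hfs, rfl⟩, rfl⟩
  refine ⟨fun G => reach G.1 G.2 fs, ?_⟩
  funext x
  ext y
  exact (runMaps_eq_some_iff_reach act M hM x (d x) (hd x) fs hfs y).symm

theorem exists_subset_range_of_ncard_le {X : Type*} [Nonempty X] {S : Set X} (hS : S.Finite)
    {C : ℕ} (hC : S.ncard ≤ C) : ∃ d : Fin C → X, S ⊆ Set.range d := by
  classical
  have hlen : hS.toFinset.toList.length ≤ C := by
    rwa [Finset.length_toList, ← Set.ncard_eq_toFinset_card S hS]
  refine ⟨fun i => hS.toFinset.toList.getD i (Classical.arbitrary X), fun y hy => ?_⟩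
  obtain ⟨i, hi, hiy⟩ := List.mem_iff_getElem.1
    (Finset.mem_toList.2 (hS.mem_toFinset.2 hy))
  exact ⟨⟨i, hi.trans_le hlen⟩, (List.getD_eq_getElem _ _ hi).trans hiy⟩

theorem length_eq_of_stateAct (δ : Q → A → Option (A × Q)) {u v : List A} {q : Q}
    (h : stateAct δ q u = some v) : v.length = u.length := by
  induction u generalizing q v with
  | nil =>
    rw [← Option.some.inj h]
  | cons a u ih =>
    simp only [stateAct, Option.bind_eq_some_iff, Option.map_eq_some_iff] at h
    obtain ⟨bp, -, w, hw, rfl⟩ := h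
    simp [ih hw]

theorem length_eq_of_seqAct (δ : Q → A → Option (A × Q)) {l : List Q} {u v : List A}
    (h : seqAct δ l u = some v) : v.length = u.length := by
  induction l generalizing v with
  | nil => rw [← Option.some.inj h]
  | cons q l ih =>
    obtain ⟨w, hw, hv⟩ := Option.bind_eq_some_iff.1 h
    rw [length_eq_of_stateAct δ hv, ih hw]

theorem finite_orbit [Finite A] (δ : Q → A → Option (A × Q)) (L : Set (List Q)) (u : List A) :
    (orbit δ L u).Finite :=
  (List.finite_length_eq A u.length).subset fun _ ⟨_, _, h⟩ => length_eq_of_seqAct δ h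

theorem seqAct_append (δ : Q → A → Option (A × Q)) (l m : List Q) (u : List A) :
    seqAct δ (l ++ m) u = (seqAct δ m u).bind (seqAct δ l) := by
  induction l with
  | nil => exact (Option.bind_fun_some _).symm
  | cons q l ih =>
    change (seqAct δ (l ++ m) u).bind (stateAct δ q) = _
    rw [ih, Option.bind_assoc]
    rfl

theorem seqAct_flatten (δ : Q → A → Option (A × Q)) (fs : List (List Q)) :
    seqAct δ fs.flatten = runMaps (seqAct δ) fs := by
  funext u
  induction fs with
  | nil => rfl
  | cons f fs ih => rw [List.flatten_cons, seqAct_append, ih]; rfl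

theorem runMaps_map {F G X : Type*} (act : G → X → Option X) (g : F → G) (fs : List F) :
    runMaps act (fs.map g) = runMaps (act ∘ g) fs := by
  funext x
  exact List.foldr_map

/-- If `L` is finitely suffix-closed and its image `L∘` is infinite,
then the empty word has infinite potential: the orbit sizes `|L∘x|` are unbounded. -/
theorem empty_word_infinite_potential {Q A : Type*} [Fintype Q] [Fintype A] [Nonempty A]
    (δ : Q → A → Option (A × Q)) (L : Set (List Q)) (hL : FinitelySuffixClosed L)
    (hinf : (mapsOf δ L).Infinite) :
    InfinitePotential δ L [] := by
  intro C
  by_contra! hC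
  obtain ⟨F, hF, -, hsc⟩ := hL
  have : Finite F := hF
  let M : Set (List F) := {gs | ∀ i, ((gs.map Subtype.val).drop i).flatten ∈ L}
  have hrun (gs : List F) :
      runMaps (seqAct δ ∘ Subtype.val) gs = seqAct δ (gs.map Subtype.val).flatten := by
    rw [seqAct_flatten, runMaps_map]
  refine hinf ((finite_image_runMaps (N := Fin C) (seqAct δ ∘ Subtype.val) M
    (fun f gs h i => h (i + 1)) fun x => ?_).subset ?_)
  · obtain ⟨d, hd⟩ := exists_subset_range_of_ncard_le (finite_orbit δ L x) (hC x)
    refine ⟨d, fun gs hgs y hy => hd ⟨_, hgs 0, ?_⟩⟩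
    rw [← hy, hrun, List.drop_zero]
  · rintro _ ⟨l, hl, rfl⟩
    obtain ⟨fs, hfs, rfl, hdrop⟩ := hsc l hl
    lift fs to List F using hfs
    exact ⟨fs, hdrop, hrun fs⟩

end AutOrbit
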